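/- arXiv:1909.10412 — 3 statements merged into one kernel-verified Lean document; each statement's English description precedes it below -/
import Mathlib

section
/- Let X be a nonempty set and n ≥ 3 an integer. An associative operation F : X^n → X is quasitrivial on D^n_{n-2} if and only if F is quasitrivial (i.e., quasitrivial on all of X^n). In other words, the class of associative n-ary operations quasitrivial on D^n_{n-2} coincides with the class of quasitrivial associative n-ary operations. -/
variable {X : Type*}

/-- The result of substituting `F` applied to the `n` consecutive entries starting at
position `i` of the `(2n-1)`-tuple `x` (given as the first `2n-1` values of `x : ℕ → X`),
and then applying `F` to the resulting `n`-tuple. -/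
def naryCompAt (n : ℕ) (F : (Fin n → X) → X) (x : ℕ → X) (i : ℕ) : X :=
  F fun j => if (j : ℕ) < i then x j
    else if (j : ℕ) = i then F (fun k => x (i + (k : ℕ)))
    else x ((j : ℕ) + n - 1)

/-- `F` is an associative `n`-ary operation. -/
def NAryAssociative (n : ℕ) (F : (Fin n → X) → X) : Prop :=
  ∀ (x : ℕ → X) (i : ℕ), i + 1 ≤ n - 1 → naryCompAt n F x i = naryCompAt n F x (i + 1)

/-- `e` is a neutral element for the `n`-ary operation `F`: inserting the argument `a` at
any position `p`, with `e` at all the other positions, returns `a`. -/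
def NAryNeutral (n : ℕ) (F : (Fin n → X) → X) (e : X) : Prop :=
  ∀ (a : X) (p : Fin n), F (Function.update (fun _ => e) p a) = a

/-- The set `E_F` of neutral elements for `F`. -/
def naryNeutralSet (n : ℕ) (F : (Fin n → X) → X) : Set X :=
  {e | NAryNeutral n F e}

/-- `e` is a neutral element for the restriction of `F` to `S^n`. -/
def NAryNeutralOn (n : ℕ) (F : (Fin n → X) → X) (S : Set X) (e : X) : Prop :=
  e ∈ S ∧ ∀ a ∈ S, ∀ p : Fin n, F (Function.update (fun _ => e) p a) = a

/-- `iterOp G m x = G (x 0) (G (x 1) (⋯ (G (x (m-1)) (x m))⋯))`,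
the `m`-fold iterate of the binary operation `G`, applied to `m+1` arguments. -/
def iterOp (G : X → X → X) : ℕ → (ℕ → X) → X
  | 0, x => x 0
  | m + 1, x => G (x 0) (iterOp G m fun i => x (i + 1))

/-- The `n`-ary operation `F` is reducible to the binary operation `G`, i.e. `F` is the
`(n-1)`-fold iterate of `G`. -/
def NAryReducibleTo (n : ℕ) (F : (Fin n → X) → X) (G : X → X → X) : Prop :=
  ∀ x : ℕ → X, F (fun i : Fin n => x i) = iterOp G (n - 1) x

/-- `gPow G a m` is the `G`-product of `m + 1` copies of `a`. -/
def gPow (G : X → X → X) (a : X) : ℕ → X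
  | 0 => a
  | m + 1 => G a (gPow G a m)

/-- `(Y, G)` is an Abelian group whose exponent divides `m` (for `m ≥ 1`): `G` maps `Y × Y`
into `Y` and is commutative and associative on `Y`, and `Y` contains a neutral element `e`
for which every element of `Y` has an inverse and such that the `G`-product of `m` copies of
any element of `Y` equals `e`. -/
def IsAbelianGroupOfExpDvdOn (Y : Set X) (G : X → X → X) (m : ℕ) : Prop :=
  (∀ a ∈ Y, ∀ b ∈ Y, G a b ∈ Y) ∧
  (∀ a ∈ Y, ∀ b ∈ Y, G a b = G b a) ∧
  (∀ a ∈ Y, ∀ b ∈ Y, ∀ c ∈ Y, G (G a b) c = G a (G b c)) ∧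
  ∃ e ∈ Y, (∀ a ∈ Y, G e a = a) ∧ (∀ a ∈ Y, ∃ b ∈ Y, G a b = e) ∧
    (∀ a ∈ Y, gPow G a (m - 1) = e)

/-- The tuple `x` lies in `D^n_k`: at least `k` of its components are equal to each other. -/
def MemD (n k : ℕ) (x : Fin n → X) : Prop :=
  ∃ S : Finset (Fin n), k ≤ S.card ∧ ∀ i ∈ S, ∀ j ∈ S, x i = x j

/-- `F` is quasitrivial on `D^n_k`. -/
def NAryQuasitrivialOnD (n k : ℕ) (F : (Fin n → X) → X) : Prop :=
  ∀ x : Fin n → X, MemD n k x → F x ∈ Set.range x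

/-- `F` is quasitrivial on `S^n_k`, the set of tuples taking at most `k` distinct values. -/
def NAryQuasitrivialOnS (n k : ℕ) (F : (Fin n → X) → X) : Prop :=
  ∀ x : Fin n → X, (Set.range x).encard ≤ k → F x ∈ Set.range x

/-- `F` is quasitrivial. -/
def NAryQuasitrivial (n : ℕ) (F : (Fin n → X) → X) : Prop :=
  ∀ x : Fin n → X, F x ∈ Set.range x

section Envelope

variable {X M : Type*} [Monoid M]

/-- The product of any `m + 2` factors of the form `ι x`, of which at least `m` are equal to
`ι a` and the others are `ι b` and `ι c`, is again one of `ι a`, `ι b`, `ι c`. -/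
def PowQuasitrivial (m : ℕ) (ι : X → M) : Prop :=
  ∀ (a b c : X) (p q r : ℕ), p + q + r = m →
    ι a ^ p * ι b * ι a ^ q * ι c * ι a ^ r = ι a ∨
    ι a ^ p * ι b * ι a ^ q * ι c * ι a ^ r = ι b ∨
    ι a ^ p * ι b * ι a ^ q * ι c * ι a ^ r = ι c

namespace PowQuasitrivial

variable {m : ℕ} {ι : X → M}

theorem pow_add_two (h : PowQuasitrivial m ι) (a : X) : ι a ^ (m + 2) = ι a := by
  have := h a a a m 0 0 (by simp)
  simpa [pow_succ] using this

theorem pow_mul_eq (h : PowQuasitrivial m ι) (a b : X) :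
    ι a ^ (m + 1) * ι b = ι a ∨ ι a ^ (m + 1) * ι b = ι b := by
  have := h a a b m 0 0 (by simp)
  simp only [pow_zero, mul_one, ← pow_succ] at this
  tauto

theorem mul_pow_eq (h : PowQuasitrivial m ι) (a b : X) :
    ι b * ι a ^ (m + 1) = ι a ∨ ι b * ι a ^ (m + 1) = ι b := by
  have := h a b a 0 0 m (by simp)
  simp only [pow_zero, mul_one, one_mul, mul_assoc, ← pow_succ'] at this
  tauto

theorem mul_eq_sq_or (h : PowQuasitrivial m ι) (a b : X) :
    ι a * ι b = ι a * ι a ∨ ι a * ι b = ι b * ι b ∨ ι a ^ (m + 1) = ι b ^ (m + 1) := by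
  have ha : ι a * ι a ^ (m + 1) = ι a := by rw [← pow_succ', h.pow_add_two]
  have hb : ι b ^ (m + 1) * ι b = ι b := by rw [← pow_succ, h.pow_add_two]
  rcases h.pow_mul_eq a b with h1 | h1
  · left
    rw [← ha, mul_assoc, h1, ha]
  rcases h.mul_pow_eq b a with h2 | h2
  · right; left
    conv_lhs => rw [← hb, ← mul_assoc, h2]
  right; right
  calc ι a ^ (m + 1) = ι a ^ m * (ι a * ι b ^ (m + 1)) := by rw [h2, pow_succ]
    _ = ι a ^ (m + 1) * ι b * ι b ^ m := by
      rw [pow_succ' (ι b), pow_succ (ι a)]; simp only [mul_assoc]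
    _ = ι b ^ (m + 1) := by rw [h1, pow_succ']

theorem left_cancel (h : PowQuasitrivial m ι) {a b c : X}
    (hb : ι a ^ (m + 1) = ι b ^ (m + 1)) (hc : ι a ^ (m + 1) = ι c ^ (m + 1))
    (he : ι a * ι b = ι a * ι c) : ι b = ι c := by
  rw [← h.pow_add_two b, ← h.pow_add_two c, pow_succ _ (m + 1), pow_succ _ (m + 1), ← hb, ← hc,
    pow_succ, mul_assoc, he, mul_assoc]

theorem right_cancel (h : PowQuasitrivial m ι) {a b c : X}
    (hb : ι a ^ (m + 1) = ι b ^ (m + 1)) (hc : ι a ^ (m + 1) = ι c ^ (m + 1))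
    (he : ι b * ι a = ι c * ι a) : ι b = ι c := by
  rw [← h.pow_add_two b, ← h.pow_add_two c, pow_succ' _ (m + 1), pow_succ' _ (m + 1), ← hb, ← hc,
    pow_succ', ← mul_assoc, he, mul_assoc]

theorem mul_mul_eq (h : PowQuasitrivial m ι) {a b : X} (hab : ι a ^ (m + 1) = ι b ^ (m + 1))
    (c : X) : ι b * ι c = ι a * ι a ∨ ι b * ι c = ι a * ι b ∨ ι b * ι c = ι a * ι c := by
  have key : ι a * (ι a ^ m * ι b * ι c) = ι b * ι c := by
    rw [← mul_assoc, ← mul_assoc, ← pow_succ', hab, ← pow_succ, h.pow_add_two]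
  have := h a b c m 0 0 (by simp)
  simp only [pow_zero, mul_one] at this
  rw [← key]
  rcases this with e | e | e <;> simp [e]

theorem mul_self_eq (h : PowQuasitrivial m ι) {a b : X} (hab : ι a ^ (m + 1) = ι b ^ (m + 1)) :
    ι b * ι b = ι a * ι a := by
  rcases h.mul_mul_eq hab b with e | e | e
  · exact e
  all_goals rw [h.right_cancel rfl hab.symm e]

theorem commute (h : PowQuasitrivial m ι) {a b : X} (hab : ι a ^ (m + 1) = ι b ^ (m + 1)) :
    Commute (ι a) (ι b) := by
  have key : ι a * ι b * ι a ^ m * ι a = ι a * ι b := by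
    rw [mul_assoc, ← pow_succ, hab, mul_assoc, ← pow_succ', h.pow_add_two]
  have := h a a b 0 0 m (by simp)
  simp only [pow_zero, mul_one, one_mul] at this
  have hc : ι a * ι b = ι a * ι a ∨ ι a * ι b = ι b * ι a := by
    rw [← key]
    rcases this with e | e | e <;> simp [e]
  rcases hc with e | e
  · rw [h.left_cancel hab rfl e]
  · exact e

theorem eq_of_pow_eq (h : PowQuasitrivial m ι) {a b c : X}
    (hb : ι a ^ (m + 1) = ι b ^ (m + 1)) (hc : ι a ^ (m + 1) = ι c ^ (m + 1)) :
    ι a = ι b ∨ ι a = ι c ∨ ι b = ι c := by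
  have hbc := hb.symm.trans hc
  rcases h.mul_mul_eq hb c with e | e | e
  · rw [← h.mul_self_eq hb] at e
    exact .inr (.inr (h.left_cancel hbc rfl e).symm)
  · rw [(h.commute hb).eq] at e
    exact .inr (.inl (h.left_cancel hbc hb.symm e).symm)
  · exact .inl (h.right_cancel hc.symm hbc.symm e.symm)

theorem _root_.mul_pow_eq_pow_succ_left {x y : M} (h : x * y = x * x) (k : ℕ) :
    x * y ^ k = x ^ (k + 1) := by
  induction k with
  | zero => simp
  | succ k ih => rw [pow_succ, ← mul_assoc, ih, pow_succ, mul_assoc, h, ← mul_assoc, ← pow_succ,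
      ← pow_succ]

theorem _root_.pow_mul_eq_pow_succ_right {x y : M} (h : x * y = y * y) (k : ℕ) :
    x ^ k * y = y ^ (k + 1) := by
  induction k with
  | zero => simp
  | succ k ih => rw [pow_succ, mul_assoc, h, ← mul_assoc, ih, ← pow_succ]

theorem exists_pow_mul_eq (h : PowQuasitrivial m ι) (c : X) (k : ℕ) (b : X) :
    ∃ a' ∈ [c, b], ∃ b' ∈ [c, b], ι a' ^ (m + 1) = ι b' ^ (m + 1) ∧
      ι c ^ k * ι b = ι a' ^ k * ι b' := by
  cases k with
  | zero => exact ⟨b, by simp, b, by simp, rfl, by simp⟩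
  | succ k =>
    rcases h.mul_eq_sq_or c b with e | e | e
    · exact ⟨c, by simp, c, by simp, rfl, by rw [pow_succ, mul_assoc, e, mul_assoc]⟩
    · exact ⟨b, by simp, b, by simp, rfl, by rw [pow_mul_eq_pow_succ_right e, pow_succ]⟩
    · exact ⟨c, by simp, b, by simp, e, rfl⟩

theorem exists_prod_eq (h : PowQuasitrivial m ι) (c : X) (l : List X) :
    ∃ a ∈ c :: l, ∃ b ∈ c :: l, ι a ^ (m + 1) = ι b ^ (m + 1) ∧
      ((c :: l).map ι).prod = ι a ^ l.length * ι b := by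
  induction l generalizing c with
  | nil => exact ⟨c, by simp, c, by simp, rfl, by simp⟩
  | cons d l ih =>
    obtain ⟨a, ha, b, hb, hab, he⟩ := ih d
    rw [List.map_cons, List.prod_cons, he, List.length_cons]
    have hca : ∀ x ∈ d :: l, x ∈ c :: d :: l := fun x hx => List.mem_cons_of_mem _ hx
    have reduce : ∀ y ∈ d :: l, ∀ z : M, z = ι c ^ (l.length + 1) * ι y →
        ∃ a ∈ c :: d :: l, ∃ b ∈ c :: d :: l, ι a ^ (m + 1) = ι b ^ (m + 1) ∧
          z = ι a ^ (l.length + 1) * ι b := by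
      rintro y hy z rfl
      obtain ⟨a', ha', b', hb', h1, h2⟩ := h.exists_pow_mul_eq c (l.length + 1) y
      have hsub : ∀ x ∈ [c, y], x ∈ c :: d :: l := by
        intro x hx
        simp only [List.mem_cons, List.not_mem_nil, or_false] at hx hy ⊢
        rcases hx with rfl | rfl <;> simp [hy]
      exact ⟨a', hsub a' ha', b', hsub b' hb', h1, h2⟩
    rcases Nat.eq_zero_or_pos l.length with h0 | hpos
    · exact reduce b hb _ (by simp [h0])
    rcases h.mul_eq_sq_or c a with e | e | e
    · exact reduce b hb _ (by rw [← mul_assoc, mul_pow_eq_pow_succ_left e])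
    · refine ⟨a, hca a ha, b, hca b hb, hab, ?_⟩
      obtain ⟨k, hk⟩ := Nat.exists_eq_succ_of_ne_zero hpos.ne'
      rw [hk, ← mul_assoc, Nat.succ_eq_add_one, pow_succ', ← mul_assoc, e, mul_assoc (ι a),
        ← pow_succ', ← pow_succ']
    · rcases h.eq_of_pow_eq e (e.trans hab) with f | f | f
      · exact ⟨a, hca a ha, b, hca b hb, hab, by rw [f, ← mul_assoc, ← pow_succ']⟩
      · refine ⟨a, hca a ha, a, hca a ha, rfl, ?_⟩
        rw [← mul_assoc, ((h.commute e).pow_right _).eq, mul_assoc, f, h.mul_self_eq hab, pow_succ,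
          mul_assoc]
      · refine ⟨a, hca a ha, c, by simp, e.symm, ?_⟩
        rw [← f, ← pow_succ, ((h.commute e).pow_right _).eq]

theorem exists_mem_prod_eq (h : PowQuasitrivial m ι) (l : List X) (hl : l.length = m + 2) :
    ∃ a ∈ l, (l.map ι).prod = ι a := by
  match l, hl with
  | c :: l, hl =>
    obtain ⟨a, -, b, hb, hab, he⟩ := h.exists_prod_eq c l
    replace hl : l.length = m + 1 := by simpa using hl
    exact ⟨b, hb, by rw [he, hl, hab, ← pow_succ, h.pow_add_two]⟩

end PowQuasitrivial

end Envelope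

section Evaluation

universe u

variable {X : Type*}

/-- `F` applied to the first `n` entries of a list, padded with `d`. -/
def listOp (n : ℕ) (F : (Fin n → X) → X) (d : X) (l : List X) : X :=
  F fun i => l.getD i d

theorem listOp_take {n : ℕ} {F : (Fin n → X) → X} (d : X) (l : List X) :
    listOp n F d (l.take n) = listOp n F d l := by
  unfold listOp
  congr 1
  ext i
  simp [List.getD_eq_getElem?_getD]

theorem listOp_append {n : ℕ} {F : (Fin n → X) → X} (d : X) {l : List X} (hl : l.length = n)
    (v : List X) : listOp n F d (l ++ v) = listOp n F d l := by
  rw [← listOp_take, List.take_left' hl]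

theorem NAryAssociative.naryCompAt_eq {n : ℕ} {F : (Fin n → X) → X} (hF : NAryAssociative n F)
    (x : ℕ → X) {i : ℕ} (hi : i ≤ n - 1) : naryCompAt n F x i = naryCompAt n F x 0 := by
  induction i with
  | zero => rfl
  | succ i ih => rw [← hF x i hi, ih (by omega)]

theorem NAryAssociative.listOp_eq {n : ℕ} {F : (Fin n → X) → X} (hF : NAryAssociative n F)
    (d : X) {u x v : List X} (hx : x.length = n) (huv : u.length + v.length + 1 = n) :
    listOp n F d (u ++ listOp n F d x :: v) =
      listOp n F d (listOp n F d (u ++ x ++ v) :: (u ++ x ++ v).drop n) := by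
  have key := hF.naryCompAt_eq (fun k => (u ++ x ++ v).getD k d) (i := u.length) (by omega)
  unfold naryCompAt at key
  unfold listOp
  convert key using 2
  · ext j
    have hj := j.isLt
    simp only [List.getD_eq_getElem?_getD]
    split_ifs with h1 h2
    · rw [List.getElem?_append_left h1, List.append_assoc, List.getElem?_append_left h1]
    · rw [List.getElem?_append_right (by omega), h2, Nat.sub_self, List.getElem?_cons_zero,
        Option.getD_some]
      congr 1
      ext k
      rw [List.append_assoc, List.getElem?_append_right (by omega), Nat.add_sub_cancel_left,
        List.getElem?_append_left (by omega)]
    · rw [List.getElem?_append_right (by omega), List.getElem?_append_right (by simp; omega),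
        List.getElem?_cons, if_neg (by omega)]
      congr 2
      simp; omega
  · ext j
    have hj := j.isLt
    simp only [List.getD_eq_getElem?_getD]
    split_ifs with h1 h2
    · omega
    · simp [h2]
    · rw [List.getElem?_cons, if_neg (by omega), List.getElem?_drop]
      congr 2
      omega

/-- The value of a word whose length is congruent to `1` modulo `n - 1`, obtained by repeatedly
applying `F` to the first `n` letters; `none` for words of other lengths. -/
def wordEval (n : ℕ) (F : (Fin n → X) → X) (d : X) (l : List X) : Option X :=
  if _h : 2 ≤ n ∧ n ≤ l.length then wordEval n F d (listOp n F d l :: l.drop n)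
  else if l.length = 1 then l.head? else none
termination_by l.length
decreasing_by simp; omega

theorem wordEval_append {n : ℕ} (hn : 2 ≤ n) (F : (Fin n → X) → X) (d : X) {l : List X}
    (hl : l.length = n) (v : List X) :
    wordEval n F d (l ++ v) = wordEval n F d (listOp n F d l :: v) := by
  rw [wordEval, dif_pos ⟨hn, by simp [hl]⟩, listOp_append d hl, List.drop_left' hl]

theorem wordEval_eq_none {n : ℕ} (F : (Fin n → X) → X) (d : X) {l : List X}
    (hl : l.length < n) (hl' : l.length ≠ 1) : wordEval n F d l = none := by
  rw [wordEval, dif_neg (by omega), if_neg hl']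

theorem wordEval_singleton {n : ℕ} (hn : 2 ≤ n) (F : (Fin n → X) → X) (d a : X) :
    wordEval n F d [a] = some a := by
  rw [wordEval, dif_neg (by simp; omega)]
  simp

theorem wordEval_subst {n : ℕ} (hn : 2 ≤ n) {F : (Fin n → X) → X} (hF : NAryAssociative n F)
    (d : X) {x : List X} (hx : x.length = n) (u v : List X) :
    wordEval n F d (u ++ (x ++ v)) = wordEval n F d (u ++ listOp n F d x :: v) := by
  induction hk : u.length using Nat.strong_induction_on generalizing u with
  | _ k ih =>
  subst hk
  rcases Nat.lt_or_ge u.length n with hu | hu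
  · rcases u.eq_nil_or_concat with rfl | hne
    · exact wordEval_append hn F d hx v
    have hu0 : u.length ≠ 0 := by
      obtain ⟨_, _, rfl⟩ := hne
      simp
    clear hne
    have hsplit : u ++ (x ++ v) = (u ++ x.take (n - u.length)) ++ (x.drop (n - u.length) ++ v) := by
      rw [List.append_assoc, ← List.append_assoc (x.take _), List.take_append_drop]
    rw [hsplit, wordEval_append hn F d (by simp; omega)]
    rcases Nat.lt_or_ge (u.length + v.length + 1) n with hv | hv
    · rw [wordEval_eq_none F d (by simp; omega) (by simp; omega),
        wordEval_eq_none F d (by simp; omega) (by simp; omega)]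
    · obtain ⟨v₁, v₂, rfl, hv₁⟩ : ∃ v₁ v₂, v = v₁ ++ v₂ ∧ u.length + v₁.length + 1 = n :=
        ⟨v.take (n - 1 - u.length), v.drop (n - 1 - u.length), by simp, by simp; omega⟩
      have e1 : listOp n F d (u ++ x.take (n - u.length)) :: (x.drop (n - u.length) ++ (v₁ ++ v₂)) =
          (listOp n F d (u ++ x.take (n - u.length)) :: (x.drop (n - u.length) ++ v₁)) ++ v₂ := by
        simp
      have e2 : u ++ listOp n F d x :: (v₁ ++ v₂) = (u ++ listOp n F d x :: v₁) ++ v₂ := by simp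
      rw [e1, e2, wordEval_append hn F d (by simp; omega), wordEval_append hn F d (by simp; omega),
        hF.listOp_eq d hx hv₁]
      have e3 : u ++ x ++ v₁ =
          (u ++ x.take (n - u.length)) ++ (x.drop (n - u.length) ++ v₁) := by
        rw [List.append_assoc, List.append_assoc, ← List.append_assoc (x.take _),
          List.take_append_drop]
      rw [e3, listOp_append d (l := u ++ x.take (n - u.length)) (by simp; omega),
        List.drop_left' (l₁ := u ++ x.take (n - u.length)) (by simp; omega)]
  · obtain ⟨u₁, u₂, rfl, hu₁⟩ : ∃ u₁ u₂, u = u₁ ++ u₂ ∧ u₁.length = n :=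
      ⟨u.take n, u.drop n, by simp, by simp; omega⟩
    rw [List.append_assoc, List.append_assoc, wordEval_append hn F d hu₁,
      wordEval_append hn F d hu₁, ← List.cons_append, ← List.cons_append]
    exact ih _ (by simp; omega) _ rfl

/-- The syntactic congruence of a map on words. -/
def syntacticCon {Y : Type*} (E : List X → Y) : Con (FreeMonoid X) where
  r w w' := ∀ u v : FreeMonoid X, E (u * w * v).toList = E (u * w' * v).toList
  iseqv := ⟨fun _ _ _ => rfl, fun h u v => (h u v).symm, fun h h' u v => (h u v).trans (h' u v)⟩
  mul' {w x y z} h h' u v := by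
    have h1 := h u (y * v)
    have h2 := h' (u * x) v
    simp only [mul_assoc] at h1 h2 ⊢
    exact h1.trans h2

/-- An associative `n`-ary operation is given by `n`-fold products in a monoid containing its
underlying set. -/
theorem NAryAssociative.exists_monoid {X : Type u} [Nonempty X] {n : ℕ} (hn : 2 ≤ n)
    {F : (Fin n → X) → X} (hF : NAryAssociative n F) :
    ∃ (M : Type u) (_ : Monoid M) (ι : X → M), Function.Injective ι ∧
      ∀ x : Fin n → X, ((List.ofFn x).map ι).prod = ι (F x) := by
  obtain ⟨d⟩ := ‹Nonempty X›
  let c := syntacticCon (wordEval n F d)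
  refine ⟨c.Quotient, inferInstance, fun x => c.mk' (FreeMonoid.of x), ?_, ?_⟩
  · intro a b hab
    have := (Con.eq c).1 hab 1 1
    simpa [wordEval_singleton hn] using this
  · intro x
    have hprod : ((List.ofFn x).map fun a => c.mk' (FreeMonoid.of a)).prod =
        c.mk' (FreeMonoid.ofList (List.ofFn x)) := by
      generalize List.ofFn x = l
      induction l with
      | nil => rfl
      | cons a l ih => rw [List.map_cons, List.prod_cons, ih, ← map_mul]; rfl
    rw [hprod]
    refine (Con.eq c).2 fun u v => ?_
    have hx : listOp n F d (List.ofFn x) = F x := by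
      unfold listOp
      congr 1
      ext i
      simp [List.getD_eq_getElem?_getD]
    have := wordEval_subst hn hF d (x := List.ofFn x) (by simp) u.toList v.toList
    rw [hx] at this
    simpa [mul_assoc] using this

end Evaluation

theorem NAryQuasitrivialOnD.powQuasitrivial {X M : Type*} [Monoid M] {m : ℕ}
    {F : (Fin (m + 2) → X) → X} (hD : NAryQuasitrivialOnD (m + 2) m F) {ι : X → M}
    (hι : ∀ x : Fin (m + 2) → X, ((List.ofFn x).map ι).prod = ι (F x)) :
    PowQuasitrivial m ι := by
  classical
  intro a b c p q r hm
  set l := List.replicate p a ++ b :: (List.replicate q a ++ c :: List.replicate r a) with hl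
  have hlen : l.length = m + 2 := by simp [hl]; omega
  let x : Fin (m + 2) → X := fun i => l[i]
  have hx : List.ofFn x = l := by
    exact List.ext_getElem (by simp only [List.length_ofFn, hlen]) fun i _ _ => by
      rw [List.getElem_ofFn]; rfl
  have hmem : MemD (m + 2) m x := by
    refine ⟨({⟨p, by omega⟩, ⟨p + q + 1, by omega⟩} : Finset (Fin (m + 2)))ᶜ, ?_, ?_⟩
    · rw [Finset.card_compl, Fintype.card_fin]
      have := Finset.card_le_two (a := (⟨p, by omega⟩ : Fin (m + 2))) (b := ⟨p + q + 1, by omega⟩)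
      omega
    · have hall : ∀ i ∈ ({⟨p, by omega⟩, ⟨p + q + 1, by omega⟩} : Finset (Fin (m + 2)))ᶜ,
          x i = a := by
        intro i hi
        simp only [Finset.mem_compl, Finset.mem_insert, Finset.mem_singleton, not_or,
          Fin.ext_iff] at hi
        simp only [x, hl, Fin.getElem_fin, List.getElem_append, List.getElem_cons,
          List.length_replicate, List.getElem_replicate]
        split_ifs <;> first | rfl | omega
      intro i hi j hj
      rw [hall i hi, hall j hj]
  have hprod := hι x
  obtain ⟨i, hi⟩ := hD x hmem
  have hil : F x ∈ l := by
    rw [← hx, List.mem_ofFn, ← hi]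
    exact ⟨i, rfl⟩
  rw [hx] at hprod
  have hprod' : ι a ^ p * ι b * ι a ^ q * ι c * ι a ^ r = ι (F x) := by
    rw [← hprod, hl]
    simp [mul_assoc]
  rw [hprod']
  simp only [hl, List.mem_append, List.mem_cons, List.mem_replicate] at hil
  rcases hil with ⟨-, e⟩ | e | ⟨-, e⟩ | e | ⟨-, e⟩ <;> simp [e]

/-- For `n ≥ 3`, an associative `n`-ary operation is quasitrivial on `D^n_{n-2}`
if and only if it is quasitrivial. -/
theorem stmt_0 {X : Type*} [Nonempty X] (n : ℕ) (hn : 3 ≤ n)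
    (F : (Fin n → X) → X) (hF : NAryAssociative n F) :
    NAryQuasitrivialOnD n (n - 2) F ↔ NAryQuasitrivial n F := by
  constructor
  · intro hD
    obtain ⟨m, rfl⟩ : ∃ m, n = m + 2 := ⟨n - 2, by omega⟩
    obtain ⟨M, _, ι, hinj, hι⟩ := hF.exists_monoid (by omega)
    intro x
    obtain ⟨a, ha, he⟩ := (hD.powQuasitrivial hι).exists_mem_prod_eq (List.ofFn x) (by simp)
    rw [hι] at he
    rw [hinj he]
    exact List.mem_ofFn.1 ha
  · exact fun h x _ => h x
end

section
/- Let X be a nonempty set and n ≥ 3. An associative operation F : X^n → X satisfies E_F = X (every element of X is a neutral element for F) if and only if there exists a binary operation G : X^2 → X such that (X,G) is an Abelian group whose exponent divides n-1 and F is the n-ary extension of G, i.e., F(x_1,…,x_n) = G(x_1, G(x_2, …, G(x_{n-1}, x_n)…)) for all x_1,…,x_n ∈ X. -/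
variable {X : Type*}

theorem NAryNeutral.apply_eq {n : ℕ} {F : (Fin n → X) → X} {e : X} (he : NAryNeutral n F e)
    {p : ℕ} (hp : p < n) {a : X} {x : Fin n → X} (hxp : x ⟨p, hp⟩ = a)
    (hx : ∀ j : Fin n, (j : ℕ) ≠ p → x j = e) : F x = a := by
  have h : x = Function.update (fun _ => e) ⟨p, hp⟩ a := by
    funext j
    by_cases hj : j = ⟨p, hp⟩
    · subst hj; simpa using hxp
    · rw [Function.update_of_ne hj]
      exact hx j fun h => hj (Fin.ext h)
  rw [h, he]

/-- If every element is neutral, the first two arguments of `F` may be exchanged. -/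
theorem NAryAssociative.swap_zero_one {n : ℕ} (hn : 3 ≤ n) {F : (Fin n → X) → X}
    (hF : NAryAssociative n F) (hE : ∀ e, NAryNeutral n F e) (a b : X) (x : ℕ → X) :
    F (fun j => if (j : ℕ) = 0 then a else if (j : ℕ) = 1 then b else x j) =
      F (fun j => if (j : ℕ) = 0 then b else if (j : ℕ) = 1 then a else x j) := by
  have h := hF (fun j => if j = n - 1 then a else if j ≤ n then b else x (j + 1 - n)) 0 (by omega)
  unfold naryCompAt at h
  beta_reduce at h
  have h₀ : F (fun k => if 0 + (k : ℕ) = n - 1 then a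
      else if 0 + (k : ℕ) ≤ n then b else x (0 + (k : ℕ) + 1 - n)) = a :=
    (hE b).apply_eq (p := n - 1) (by omega) (by simp) fun j hj => by
      have := j.2
      rw [if_neg (by omega), if_pos (by omega)]
  have h₁ : F (fun k => if 0 + 1 + (k : ℕ) = n - 1 then a
      else if 0 + 1 + (k : ℕ) ≤ n then b else x (0 + 1 + (k : ℕ) + 1 - n)) = a :=
    (hE b).apply_eq (p := n - 2) (by omega) (if_pos (by dsimp only; omega)) fun j hj => by
      have := j.2
      rw [if_neg (by omega), if_pos (by omega)]
  rw [h₀, h₁] at h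
  refine (congrArg F (funext fun j => ?_)).trans (h.trans (congrArg F (funext fun j => ?_)))
  · rcases j with ⟨_ | _ | j, hj⟩
    · simp
    · have h1 : ¬ n = n - 1 := by omega
      simp [h1]
    · have h1 : ¬ j + 1 + 1 + n - 1 = n - 1 := by omega
      have h2 : ¬ j + 1 + 1 + n - 1 ≤ n := by omega
      have h3 : j + 1 + 1 + n - 1 + 1 - n = j + 1 + 1 := by omega
      simp only [h1, h2, h3]
      simp
  · rcases j with ⟨_ | _ | j, hj⟩
    · have h1 : ¬ 0 = n - 1 := by omega
      simp [h1]
    · simp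
    · have h1 : ¬ j + 1 + 1 + n - 1 = n - 1 := by omega
      have h2 : ¬ j + 1 + 1 + n - 1 ≤ n := by omega
      have h3 : j + 1 + 1 + n - 1 + 1 - n = j + 1 + 1 := by omega
      simp only [h1, h2, h3]
      simp

/-- The binary operation `(a, b) ↦ F (a, b, e, …, e)`. -/
def naryRetract (n : ℕ) (F : (Fin n → X) → X) (e a b : X) : X :=
  F fun j => if (j : ℕ) = 0 then a else if (j : ℕ) = 1 then b else e

theorem iterOp_naryRetract {n : ℕ} {F : (Fin n → X) → X}
    (hF : NAryAssociative n F) {e : X} (he : NAryNeutral n F e) (m : ℕ) (hm : m < n)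
    (x : ℕ → X) :
    iterOp (naryRetract n F e) m x = F fun j => if (j : ℕ) ≤ m then x j else e := by
  induction m generalizing x with
  | zero =>
    exact (he.apply_eq (p := 0) hm (by simp [iterOp]) fun j hj => by simp [hj]).symm
  | succ m ih =>
    have h := hF (fun j => if j ≤ m + 1 then x j else e) 0 (by omega)
    simp only [naryCompAt, Nat.not_lt_zero, if_false, Nat.zero_add] at h
    rw [he.apply_eq (p := 0) (by omega) (if_pos rfl) (fun j hj => by
      rw [if_neg hj, if_neg (by omega)])] at h
    rw [iterOp, ih (by omega), naryRetract, h]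
    congr 1
    funext j
    rcases j with ⟨_ | _ | j, hj⟩
    · simp
    · simp [Nat.add_comm 1]
    · have h1 : ¬ j + 1 + 1 + n - 1 ≤ m + 1 := by omega
      simp only [h1]
      simp

theorem iterOp_const (G : X → X → X) (b : X) (m : ℕ) :
    iterOp G m (fun _ => b) = gPow G b m := by
  induction m with
  | zero => rfl
  | succ m ih => rw [iterOp, gPow, ih]

theorem iterOp_ite_eq {G : X → X → X} (hc : ∀ a b, G a b = G b a)
    (ha : ∀ a b c, G (G a b) c = G a (G b c)) (a b : X) (m p : ℕ) (hp : p ≤ m + 1) :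
    iterOp G (m + 1) (fun j => if j = p then a else b) = G a (gPow G b m) := by
  induction m generalizing p with
  | zero =>
    obtain rfl | rfl : p = 0 ∨ p = 1 := by omega
    · simp [iterOp, gPow]
    · simp [iterOp, gPow, hc]
  | succ m ih =>
    rcases p with _ | p
    · rw [iterOp]
      simp [iterOp_const]
    · rw [iterOp]
      simp only [Nat.add_right_cancel_iff]
      rw [ih p (by omega), gPow, if_neg (by omega), ← ha, hc b a, ha]

/-- For an associative `F : X^n → X`, every element of `X` is neutral for `F` iff `F` is the
`n`-ary extension of an Abelian group operation on `X` whose exponent divides `n - 1`. -/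
theorem stmt_2 {X : Type*} [Nonempty X] (n : ℕ) (hn : 3 ≤ n)
    (F : (Fin n → X) → X) (hF : NAryAssociative n F) :
    naryNeutralSet n F = Set.univ ↔
      ∃ G : X → X → X, IsAbelianGroupOfExpDvdOn (Set.univ : Set X) G (n - 1) ∧
        NAryReducibleTo n F G := by
  obtain ⟨k, rfl⟩ : ∃ k, n = k + 3 := ⟨n - 3, by omega⟩
  constructor
  · intro h
    have hE : ∀ e, NAryNeutral (k + 3) F e := Set.eq_univ_iff_forall.mp h
    obtain ⟨e⟩ := ‹Nonempty X›
    set G := naryRetract (k + 3) F e with hG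
    have hred : NAryReducibleTo (k + 3) F G := fun x => by
      rw [hG, iterOp_naryRetract hF (hE e) _ (by omega)]
      congr 1
      funext j
      rw [if_pos (by omega)]
    have hcomm : ∀ a b, G a b = G b a := fun a b =>
      hF.swap_zero_one hn hE a b fun _ => e
    have hleft : ∀ a b c, G a (G b c) = G b (G a c) := by
      have key : ∀ a b c, G a (G b c) = F (fun j => if (j : ℕ) = 0 then a
          else if (j : ℕ) = 1 then b else (fun i : ℕ => if i = 2 then c else e) j) := by
        intro a b c
        have h2 := iterOp_naryRetract hF (hE e) 2 (by omega)
          (fun j => if j = 0 then a else if j = 1 then b else c)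
        simp only [iterOp] at h2
        refine Eq.trans (by simp [hG]) (h2.trans ?_)
        congr 1
        funext j
        rcases j with ⟨_ | _ | _ | j, hj⟩ <;> simp
      intro a b c
      rw [key, key]
      exact hF.swap_zero_one hn hE a b fun i => if i = 2 then c else e
    have hassoc : ∀ a b c, G (G a b) c = G a (G b c) := fun a b c => by
      rw [hcomm, hleft, hcomm c b]
    have hone : ∀ a, G a e = a := fun a =>
      (hE e).apply_eq (p := 0) (by omega) (by simp) fun j hj => by simp [hj]
    have hpow : ∀ a, gPow G a (k + 1) = e := fun a => by
      have h1 := hred fun j => if j = 0 then e else a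
      rw [(hE a).apply_eq (p := 0) (a := e) (by omega) (by simp) fun j hj => by simp [hj],
        show k + 3 - 1 = k + 1 + 1 by omega,
        iterOp_ite_eq hcomm hassoc _ _ _ _ (by omega), hcomm, hone] at h1
      exact h1.symm
    exact ⟨G, ⟨fun _ _ _ _ => Set.mem_univ _, fun a _ b _ => hcomm a b,
      fun a _ b _ c _ => hassoc a b c, e, Set.mem_univ _,
      fun a _ => (hcomm e a).trans (hone a), fun a _ => ⟨gPow G a k, Set.mem_univ _, hpow a⟩,
      fun a _ => hpow a⟩, hred⟩
  · rintro ⟨G, ⟨-, hcomm, hassoc, e, -, hone, -, hpow⟩, hred⟩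
    simp only [Set.mem_univ, forall_const] at hcomm hassoc hone hpow
    refine Set.eq_univ_of_forall fun b a p => ?_
    have h1 := hred fun j => if j = (p : ℕ) then a else b
    rw [show k + 3 - 1 = k + 1 + 1 by omega,
      iterOp_ite_eq hcomm hassoc _ _ _ _ (by omega), show k + 1 = k + 3 - 1 - 1 by omega,
      hpow, hcomm, hone] at h1
    rw [← h1]
    congr 1
    funext j
    simp [Function.update_apply, Fin.ext_iff, h1]
end

section
/- Let X be a nonempty set, n ≥ 3, let F : X^n → X be associative with E_F nonempty, and let x ∈ X. Then the restriction of F to ({x} ∪ E_F)^n is symmetric, i.e., F(y_1,…,y_n) = F(y_{σ(1)},…,y_{σ(n)}) for every permutation σ of {1,…,n} and all y_1,…,y_n ∈ {x} ∪ E_F. -/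
variable {X : Type*}

/-- A neutral argument of an associative operation commutes with the argument following it. -/
theorem NAryAssociative.comp_swap_of_neutral {X : Type*} {m : ℕ} {F : (Fin (m + 1) → X) → X}
    (hF : NAryAssociative (m + 1) F) (i : Fin m) (y : Fin (m + 1) → X)
    (hy : NAryNeutral (m + 1) F (y i.castSucc)) :
    F (y ∘ Equiv.swap i.castSucc i.succ) = F y := by
  obtain ⟨i, hi⟩ := i
  set e := y (Fin.castSucc ⟨i, hi⟩) with he
  set u := y (Fin.succ ⟨i, hi⟩) with hu
  have key := hF (fun j => if j < i then y (Fin.ofNat (m + 1) j) else if j = i + 1 then u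
    else if j ≤ i + (m + 1) then e else y (Fin.ofNat (m + 1) (j - m))) i (by omega)
  have left : F (fun k : Fin (m + 1) => if (k : ℕ) = 1 then u else e) = u := by
    refine (congrArg F ?_).trans (hy u ⟨1, by omega⟩)
    ext k
    simp only [Function.update_apply, Fin.ext_iff]
  have right : F (fun k : Fin (m + 1) => if (k : ℕ) = 0 then u else e) = u := by
    refine (congrArg F ?_).trans (hy u ⟨0, by omega⟩)
    ext k
    simp only [Function.update_apply, Fin.ext_iff]
  unfold naryCompAt at key
  convert key using 2
  · ext ⟨j, hj⟩
    rcases lt_trichotomy j i with h | rfl | h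
    · rw [Function.comp_apply, Equiv.swap_apply_of_ne_of_ne]
      · simp [h, Fin.ofNat, Nat.mod_eq_of_lt hj]
      all_goals simp [Fin.ext_iff]; omega
    · have : (⟨j, hj⟩ : Fin (m + 1)) = Fin.castSucc ⟨j, hi⟩ := rfl
      rw [Function.comp_apply, this, Equiv.swap_apply_left, ← hu]
      simp only [Fin.val_castSucc, lt_irrefl, if_false, if_true]
      refine left.symm.trans (congrArg F ?_)
      ext k
      grind
    · rcases eq_or_ne j (i + 1) with rfl | h'
      · have : (⟨i + 1, hj⟩ : Fin (m + 1)) = Fin.succ ⟨i, hi⟩ := rfl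
        rw [Function.comp_apply, this, Equiv.swap_apply_right, ← he]
        grind
      · rw [Function.comp_apply, Equiv.swap_apply_of_ne_of_ne]
        · have : Fin.ofNat (m + 1) (j + (m + 1) - 1 - m) = ⟨j, hj⟩ := by
            ext
            simp [Fin.ofNat, Nat.mod_eq_of_lt hj]
          grind
        all_goals simp [Fin.ext_iff]; omega
  · ext ⟨j, hj⟩
    have mod : Fin.ofNat (m + 1) j = ⟨j, hj⟩ := by
      ext
      simp [Fin.ofNat, Nat.mod_eq_of_lt hj]
    rcases lt_trichotomy j (i + 1) with h | rfl | h
    · rcases eq_or_ne j i with rfl | h'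
      · have : (⟨j, hj⟩ : Fin (m + 1)) = Fin.castSucc ⟨j, hi⟩ := rfl
        rw [this, ← he]
        grind
      · grind
    · have : (⟨i + 1, hj⟩ : Fin (m + 1)) = Fin.succ ⟨i, hi⟩ := rfl
      rw [this, ← hu]
      simp only [Fin.val_succ, lt_irrefl, if_false, if_true]
      refine right.symm.trans (congrArg F ?_)
      ext k
      grind
    · have : j + (m + 1) - 1 - m = j := by omega
      grind

/-- If `F` is associative with at least one neutral element, then for any `a ∈ X` the
restriction of `F` to `({a} ∪ E_F)^n` is symmetric. -/
theorem stmt_5 {X : Type*} [Nonempty X] (n : ℕ) (hn : 3 ≤ n)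
    (F : (Fin n → X) → X) (hF : NAryAssociative n F)
    (hE : (naryNeutralSet n F).Nonempty) (a : X) :
    ∀ (σ : Equiv.Perm (Fin n)) (y : Fin n → X),
      (∀ i, y i ∈ insert a (naryNeutralSet n F)) → F (y ∘ σ) = F y := by
  obtain ⟨m, rfl⟩ : ∃ m, n = m + 1 := ⟨n - 1, by omega⟩
  intro σ
  have hσ : σ ∈ Submonoid.closure
      (Set.range fun i : Fin m => Equiv.swap i.castSucc i.succ) := by
    rw [Equiv.Perm.mclosure_swap_castSucc_succ]
    trivial
  induction hσ using Submonoid.closure_induction with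
  | mem τ hτ =>
    obtain ⟨i, rfl⟩ := hτ
    intro y hy
    rcases hy i.castSucc with h | h
    · rcases hy i.succ with h' | h'
      · rw [Equiv.comp_swap_eq_update, h, h', ← h', Function.update_eq_self, h', ← h,
          Function.update_eq_self]
      · have := hF.comp_swap_of_neutral i (y ∘ Equiv.swap i.castSucc i.succ) (by
          rwa [Function.comp_apply, Equiv.swap_apply_left])
        rw [← this]
        congr 1
        ext k
        simp
    · exact hF.comp_swap_of_neutral i y h
  | one => simp
  | mul τ ρ _ _ hτ hρ =>
    intro y hy
    rw [Equiv.Perm.coe_mul, ← Function.comp_assoc, hρ (y ∘ τ) fun i => hy (τ i), hτ y hy]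
end
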